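/- The union over s ≥ 1 of the translated Minkowski sums 4 + (K̃(b^s) + K(c^s)) and 4 + (K(b^s) + K(b^s)) covers the half-open interval [1 + √21, √32): that is, ⋃_{s≥1} [ (4 + K̃(b^s) + K(c^s)) ∪ (4 + K(b^s) + K(b^s)) ] ⊇ [1 + √21, √32). -/

import Mathlib

open Filter Set
open scoped Pointwise

noncomputable section

/-- The `n`-th convergent of the continued fraction `[0; a 0, a 1, a 2, …]`. -/
def cfConv : ℕ → (ℕ → ℕ) → ℝ
  | 0, _ => 0
  | n + 1, a => 1 / (a 0 + cfConv n fun i => a (i + 1))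

/-- The value `[0; a 0, a 1, a 2, …]` of the infinite continued fraction with
partial quotients `a 0, a 1, …` (the limit of its convergents). -/
def cfVal (a : ℕ → ℕ) : ℝ := limUnder atTop fun n => cfConv n a

/-- The sequence of partial quotients obtained by concatenating the finite word `b`
with the sequence `θ`. -/
def app (b : List ℕ) (θ : ℕ → ℕ) : ℕ → ℕ := fun n =>
  if h : n < b.length then b.get ⟨n, h⟩ else θ (n - b.length)

/-- The forbidden pairs of consecutive partial quotients. -/
def badPairs : Set (ℕ × ℕ) := {(1, 4), (2, 4)}

/-- The set `D` of sequences with entries in `{1,2,3,4}` avoiding the pairs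
`(1,4)` and `(2,4)`. -/
def Dset : Set (ℕ → ℕ) :=
  {θ | (∀ n, θ n ∈ ({1, 2, 3, 4} : Set ℕ)) ∧ ∀ n, (θ n, θ (n + 1)) ∉ badPairs}

/-- The Cantor set `K(b) = {[0; b, θ] : θ ∈ D, (b_s, θ_1) ∉ {(1,4),(2,4)}}`. -/
def Kb (b : List ℕ) : Set ℝ :=
  {x | ∃ θ ∈ Dset, (∀ d, b.getLast? = some d → (d, θ 0) ∉ badPairs) ∧
    x = cfVal (app b θ)}

/-- The set `K̃(b) ⊆ K(b)` of values `[0; b, θ]` with moreover `(θ_1, θ_2) ≠ (1,3)`. -/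
def Ktil (b : List ℕ) : Set ℝ :=
  {x | ∃ θ ∈ Dset, (∀ d, b.getLast? = some d → (d, θ 0) ∉ badPairs) ∧
    (θ 0, θ 1) ≠ (1, 3) ∧ x = cfVal (app b θ)}

/-- The word `b^s = (1,4)_s`. -/
def bW (s : ℕ) : List ℕ := (List.replicate s [1, 4]).flatten

/-- The word `c^s = (1,4)_{s-1}, 1, 3`. -/
def cW (s : ℕ) : List ℕ := bW (s - 1) ++ [1, 3]

/-- The periodic sequence `\overline{1,3}`. -/
def per13 : ℕ → ℕ := fun n => if n % 2 = 0 then 1 else 3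

/-- The periodic sequence `\overline{3,1}`. -/
def per31 : ℕ → ℕ := fun n => if n % 2 = 0 then 3 else 1

open scoped Topology

/-- If every node of a binary tree of intervals splits into two bridges that are at least as long as
the gap between them, and gaps do not grow when passing to a child, then the sum of two trees whose
roots are at least as long as each other's gap fills the sum of the two intervals. -/
theorem mem_add_of_split {N : Type*} (lo hi gap : N → ℝ) (K : N → Set ℝ) {κ : ℝ} (hκ : 0 < κ)
    (hκ1 : κ ≤ 1) (hlo : ∀ n, lo n ∈ K n) (hle : ∀ n, lo n ≤ hi n)
    (hsplit : ∀ n, ∃ l r, lo l = lo n ∧ hi r = hi n ∧ lo r - hi l = gap n ∧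
      gap n ≤ hi l - lo l ∧ gap n ≤ hi r - lo r ∧ gap l ≤ gap n ∧ gap r ≤ gap n ∧
      κ * (hi n - lo n) ≤ gap n ∧ K l ⊆ K n ∧ K r ⊆ K n)
    {i j : N} (hij : gap i ≤ hi j - lo j) (hji : gap j ≤ hi i - lo i)
    (hclosed : IsClosed (K i + K j)) {x : ℝ} (hx : x ∈ Icc (lo i + lo j) (hi i + hi j)) :
    x ∈ K i + K j := by
  have step : ∀ i j : N, gap i ≤ hi j - lo j → gap j ≤ hi i - lo i →
      lo i + lo j ≤ x → x ≤ hi i + hi j → ∃ i' j', gap i' ≤ hi j' - lo j' ∧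
      gap j' ≤ hi i' - lo i' ∧ lo i' + lo j' ≤ x ∧ x ≤ hi i' + hi j' ∧ K i' ⊆ K i ∧ K j' ⊆ K j ∧
      (hi i' - lo i') + (hi j' - lo j') ≤ (1 - κ ^ 2) * ((hi i - lo i) + (hi j - lo j)) := by
    intro i j hij hji h1 h2
    obtain ⟨l, r, e1, e2, e3, b1, b2, g1, g2, k, s1, s2⟩ := hsplit i
    obtain ⟨l', r', e1', e2', e3', b1', b2', g1', g2', k', s1', s2'⟩ := hsplit j
    have hi0 := hle i
    have hj0 := hle j
    have shrink : ∀ a b : ℝ, 0 ≤ a → 0 ≤ b → κ * b ≤ a → κ ^ 2 * (a + b) ≤ 2 * (κ * a) := by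
      intro a b ha hb hab
      nlinarith [mul_le_mul_of_nonneg_left hab hκ.le, mul_nonneg hκ.le ha]
    by_cases hc : gap j ≤ hi l - lo l ∧ gap j ≤ hi r - lo r
    · have := shrink _ _ (sub_nonneg.2 hi0) (sub_nonneg.2 hj0) (by linarith)
      by_cases hxl : x ≤ hi l + hi j
      · exact ⟨l, j, by linarith, hc.1, by linarith, hxl, s1, Subset.rfl, by linarith⟩
      · exact ⟨r, j, by linarith, hc.2, by linarith, by linarith, s2, Subset.rfl, by linarith⟩
    · have hc' : gap i ≤ gap j := by
        by_contra hlt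
        exact hc ⟨by linarith, by linarith⟩
      have := shrink _ _ (sub_nonneg.2 hj0) (sub_nonneg.2 hi0) (by linarith)
      by_cases hxl : x ≤ hi i + hi l'
      · exact ⟨i, l', by linarith, by linarith, by linarith, hxl, Subset.rfl, s1', by linarith⟩
      · exact ⟨i, r', by linarith, by linarith, by linarith, by linarith, Subset.rfl, s2',
          by linarith⟩
  have iter : ∀ n : ℕ, ∃ i' j', gap i' ≤ hi j' - lo j' ∧
      gap j' ≤ hi i' - lo i' ∧ lo i' + lo j' ≤ x ∧ x ≤ hi i' + hi j' ∧ K i' ⊆ K i ∧ K j' ⊆ K j ∧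
      (hi i' - lo i') + (hi j' - lo j') ≤ (1 - κ ^ 2) ^ n * ((hi i - lo i) + (hi j - lo j)) := by
    intro n
    induction n with
    | zero => exact ⟨i, j, hij, hji, hx.1, hx.2, Subset.rfl, Subset.rfl, by simp⟩
    | succ n ih =>
      obtain ⟨i', j', h1, h2, h3, h4, h5, h6, h7⟩ := ih
      obtain ⟨i'', j'', h1', h2', h3', h4', h5', h6', h7'⟩ := step i' j' h1 h2 h3 h4
      refine ⟨i'', j'', h1', h2', h3', h4', h5'.trans h5, h6'.trans h6, h7'.trans ?_⟩
      rw [pow_succ' (1 - κ ^ 2) n, mul_assoc]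
      exact mul_le_mul_of_nonneg_left h7 (by nlinarith)
  rw [← hclosed.closure_eq, Metric.mem_closure_iff]
  intro ε hε
  have hlim : Tendsto (fun n : ℕ => (1 - κ ^ 2) ^ n * ((hi i - lo i) + (hi j - lo j)))
      atTop (𝓝 (0 * ((hi i - lo i) + (hi j - lo j)))) :=
    (tendsto_pow_atTop_nhds_zero_of_lt_one (by nlinarith) (by nlinarith)).mul_const _
  rw [zero_mul] at hlim
  obtain ⟨n, hn⟩ := (hlim.eventually (gt_mem_nhds hε)).exists
  obtain ⟨i', j', -, -, h3, h4, h5, h6, h7⟩ := iter n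
  refine ⟨lo i' + lo j', add_mem_add (h5 (hlo i')) (h6 (hlo j')), ?_⟩
  rw [Real.dist_eq, abs_of_nonneg (by linarith)]
  linarith

/-- Prepend a partial quotient to a sequence. -/
def seqCons (a : ℕ) (θ : ℕ → ℕ) : ℕ → ℕ
  | 0 => a
  | n + 1 => θ n

/-- Sequences with entries in `{1,2,3,4}`. -/
def digitSeqs : Set (ℕ → ℕ) := {θ | ∀ n, θ n ∈ ({1, 2, 3, 4} : Set ℕ)}

theorem one_le_of_digit {d : ℕ} (h : d ∈ ({1, 2, 3, 4} : Set ℕ)) : (1 : ℝ) ≤ d := by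
  rcases h with rfl | rfl | rfl | rfl <;> norm_num

theorem digit_le_four {d : ℕ} (h : d ∈ ({1, 2, 3, 4} : Set ℕ)) : (d : ℝ) ≤ 4 := by
  rcases h with rfl | rfl | rfl | rfl <;> norm_num

theorem digitSeqs_tail {a : ℕ → ℕ} (ha : a ∈ digitSeqs) : (fun i => a (i + 1)) ∈ digitSeqs :=
  fun n => ha (n + 1)

theorem cfConv_mem_Icc (n : ℕ) {a : ℕ → ℕ} (ha : a ∈ digitSeqs) : cfConv n a ∈ Icc (0 : ℝ) 1 := by
  induction n generalizing a with
  | zero => simp [cfConv]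
  | succ n ih =>
    have h1 := ih (digitSeqs_tail ha)
    have h2 := one_le_of_digit (ha 0)
    have h3 : (0 : ℝ) < a 0 + cfConv n fun i => a (i + 1) := by linarith [h1.1]
    refine ⟨by rw [cfConv]; positivity, ?_⟩
    rw [cfConv, div_le_one h3]
    linarith [h1.1]

theorem cfConv_succ_ge (n : ℕ) {a : ℕ → ℕ} (ha : a ∈ digitSeqs) : 1 / 5 ≤ cfConv (n + 1) a := by
  have h1 := cfConv_mem_Icc n (digitSeqs_tail ha)
  have h2 := one_le_of_digit (ha 0)
  have h3 := digit_le_four (ha 0)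
  rw [cfConv]
  exact one_div_le_one_div_of_le (by linarith [h1.1]) (by linarith [h1.2])

theorem abs_one_div_sub_le {d x y : ℝ} (hd : 1 ≤ d) (hx : 1 / 5 ≤ x) (hy : 1 / 5 ≤ y) :
    |1 / (d + x) - 1 / (d + y)| ≤ 25 / 36 * |x - y| := by
  have h1 : 6 / 5 ≤ d + x := by linarith
  have h2 : 6 / 5 ≤ d + y := by linarith
  have h3 : 36 / 25 ≤ (d + x) * (d + y) := by nlinarith
  have h4 : 1 / (d + x) - 1 / (d + y) = -((x - y) / ((d + x) * (d + y))) := by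
    field_simp
    ring
  rw [h4, abs_neg, abs_div, abs_of_pos (by linarith : 0 < (d + x) * (d + y)),
    div_le_iff₀ (by linarith)]
  nlinarith [abs_nonneg (x - y)]

theorem abs_cfConv_sub_le (k n m : ℕ) {a b : ℕ → ℕ} (ha : a ∈ digitSeqs) (hb : b ∈ digitSeqs)
    (hab : ∀ i < k, a i = b i) :
    |cfConv (k + n + 1) a - cfConv (k + m + 1) b| ≤ (25 / 36) ^ k := by
  induction k generalizing a b with
  | zero =>
    have h1 := cfConv_mem_Icc (0 + n + 1) ha
    have h2 := cfConv_mem_Icc (0 + m + 1) hb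
    rw [pow_zero, abs_le]
    constructor <;> linarith [h1.1, h1.2, h2.1, h2.2]
  | succ k ih =>
    have h := ih (digitSeqs_tail ha) (digitSeqs_tail hb) fun i hi => hab (i + 1) (by omega)
    rw [show k + 1 + n + 1 = (k + n + 1) + 1 by ring, show k + 1 + m + 1 = (k + m + 1) + 1 by ring,
      cfConv, cfConv, hab 0 (by omega), pow_succ']
    refine (abs_one_div_sub_le (one_le_of_digit (hb 0)) (cfConv_succ_ge _ (digitSeqs_tail ha))
      (cfConv_succ_ge _ (digitSeqs_tail hb))).trans ?_
    linarith

theorem tendsto_cfConv {a : ℕ → ℕ} (ha : a ∈ digitSeqs) :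
    Tendsto (fun n => cfConv n a) atTop (𝓝 (cfVal a)) := by
  have hc : CauchySeq fun n => cfConv (n + 1) a := by
    refine cauchySeq_of_le_geometric (25 / 36) 1 (by norm_num) fun n => ?_
    rw [Real.dist_eq, one_mul]
    exact abs_cfConv_sub_le n 0 1 ha ha fun _ _ => rfl
  obtain ⟨x, hx⟩ := cauchySeq_tendsto_of_complete hc
  exact tendsto_nhds_limUnder ⟨x, (tendsto_add_atTop_iff_nat 1).1 hx⟩

theorem cfVal_mem_Icc {a : ℕ → ℕ} (ha : a ∈ digitSeqs) : cfVal a ∈ Icc (0 : ℝ) 1 :=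
  isClosed_Icc.mem_of_tendsto (tendsto_cfConv ha)
    (Eventually.of_forall fun n => cfConv_mem_Icc n ha)

theorem cfVal_eq {a : ℕ → ℕ} (ha : a ∈ digitSeqs) :
    cfVal a = 1 / (a 0 + cfVal fun i => a (i + 1)) := by
  have h1 := one_le_of_digit (ha 0)
  have h2 := (cfVal_mem_Icc (digitSeqs_tail ha)).1
  refine tendsto_nhds_unique ((tendsto_add_atTop_iff_nat 1).2 (tendsto_cfConv ha)) ?_
  exact tendsto_const_nhds.div ((tendsto_cfConv (digitSeqs_tail ha)).const_add _)
    (by linarith)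

theorem abs_cfVal_sub_le (k : ℕ) {a b : ℕ → ℕ} (ha : a ∈ digitSeqs) (hb : b ∈ digitSeqs)
    (hab : ∀ i < k, a i = b i) : |cfVal a - cfVal b| ≤ (25 / 36) ^ k := by
  have h := (((tendsto_cfConv ha).sub (tendsto_cfConv hb)).abs)
  have h' := (tendsto_add_atTop_iff_nat (k + 1)).2 h
  refine le_of_tendsto h' (Eventually.of_forall fun n => ?_)
  have := abs_cfConv_sub_le k n n ha hb hab
  rwa [show n + (k + 1) = k + n + 1 by ring]

theorem continuousOn_cfVal : ContinuousOn cfVal digitSeqs := by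
  intro a ha
  rw [ContinuousWithinAt, Metric.tendsto_nhds]
  intro ε hε
  obtain ⟨k, hk⟩ := exists_pow_lt_of_lt_one hε (by norm_num : (25 / 36 : ℝ) < 1)
  have hU : {b : ℕ → ℕ | ∀ i < k, b i = a i} ∈ 𝓝 a := by
    have : {b : ℕ → ℕ | ∀ i < k, b i = a i} = (Set.Iio k).pi fun i => {a i} := by
      ext b; simp [Set.mem_pi]
    rw [this]
    exact set_pi_mem_nhds (Set.finite_Iio k) fun i _ => by simp
  filter_upwards [mem_nhdsWithin_of_mem_nhds hU, self_mem_nhdsWithin] with b hb hbd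
  rw [Real.dist_eq]
  exact (abs_cfVal_sub_le k hbd ha hb).trans_lt hk

/-- The sequences of `Dset` whose first entry lies between `j` and `k`. -/
def startSeqs (j k : ℕ) : Set (ℕ → ℕ) := {θ | θ ∈ Dset ∧ j ≤ θ 0 ∧ θ 0 ≤ k}

theorem startSeqs_subset (j k : ℕ) : startSeqs j k ⊆ digitSeqs := fun _ h => h.1.1

theorem isCompact_startSeqs (j k : ℕ) : IsCompact (startSeqs j k) := by
  have hK : IsCompact (Set.univ.pi fun _ : ℕ => ({1, 2, 3, 4} : Set ℕ)) :=
    isCompact_univ_pi fun _ => (Set.toFinite _).isCompact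
  refine hK.of_isClosed_subset ?_ fun θ h n _ => h.1.1 n
  have h1 : ∀ n, IsClosed {θ : ℕ → ℕ | θ n ∈ ({1, 2, 3, 4} : Set ℕ)} := fun n =>
    (isClosed_discrete _).preimage (continuous_apply n)
  have h2 : ∀ n, IsClosed {θ : ℕ → ℕ | (θ n, θ (n + 1)) ∉ badPairs} := fun n =>
    IsClosed.preimage (f := fun θ : ℕ → ℕ => (θ n, θ (n + 1))) (by fun_prop)
      (isClosed_discrete badPairsᶜ)
  have h3 : IsClosed {θ : ℕ → ℕ | j ≤ θ 0 ∧ θ 0 ≤ k} :=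
    IsClosed.preimage (f := fun θ : ℕ → ℕ => θ 0) (by fun_prop) (isClosed_discrete (Icc j k))
  have : startSeqs j k = ((⋂ n, {θ : ℕ → ℕ | θ n ∈ ({1, 2, 3, 4} : Set ℕ)}) ∩
      ⋂ n, {θ : ℕ → ℕ | (θ n, θ (n + 1)) ∉ badPairs}) ∩ {θ | j ≤ θ 0 ∧ θ 0 ≤ k} := by
    ext θ
    simp [startSeqs, Dset]
  rw [this]
  exact ((isClosed_iInter h1).inter (isClosed_iInter h2)).inter h3

/-- The values of the continued fractions of `startSeqs j k`. -/
def startVals (j k : ℕ) : Set ℝ := cfVal '' startSeqs j k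

theorem isCompact_startVals (j k : ℕ) : IsCompact (startVals j k) :=
  (isCompact_startSeqs j k).image_of_continuousOn
    (continuousOn_cfVal.mono (startSeqs_subset j k))

theorem startVals_subset_Icc (j k : ℕ) : startVals j k ⊆ Icc 0 1 := by
  rintro _ ⟨θ, h, rfl⟩
  exact cfVal_mem_Icc (startSeqs_subset j k h)

theorem startVals_mono {j k j' k' : ℕ} (hj : j' ≤ j) (hk : k ≤ k') :
    startVals j k ⊆ startVals j' k' :=
  image_mono fun _ h => ⟨h.1, hj.trans h.2.1, h.2.2.trans hk⟩

/-- The largest partial quotient that may follow `a`. -/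
def maxNext (a : ℕ) : ℕ := if a ≤ 2 then 3 else 4

theorem seqCons_mem {a : ℕ} (ha1 : 1 ≤ a) (ha4 : a ≤ 4) {θ : ℕ → ℕ} (hθ : θ ∈ Dset)
    (h0 : θ 0 ≤ maxNext a) : seqCons a θ ∈ Dset := by
  refine ⟨fun n => ?_, fun n => ?_⟩
  · cases n with
    | zero => simp only [seqCons, Set.mem_insert_iff, Set.mem_singleton_iff]; omega
    | succ n => exact hθ.1 n
  · cases n with
    | zero =>
      simp only [seqCons, badPairs, Set.mem_insert_iff, Set.mem_singleton_iff, Prod.mk.injEq]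
      unfold maxNext at h0
      split_ifs at h0 <;> omega
    | succ n => exact hθ.2 n

theorem cfVal_seqCons {a : ℕ} {θ : ℕ → ℕ} (h : seqCons a θ ∈ digitSeqs) :
    cfVal (seqCons a θ) = 1 / (a + cfVal θ) :=
  cfVal_eq h

theorem one_div_add_mem {j k a : ℕ} (hj : 1 ≤ j) (hk : k ≤ 4) (hja : j ≤ a) (hak : a ≤ k)
    {v : ℝ} (hv : v ∈ startVals 1 (maxNext a)) : 1 / (a + v) ∈ startVals j k := by
  obtain ⟨θ, hθ, rfl⟩ := hv
  have h := seqCons_mem (hj.trans hja) (hak.trans hk) hθ.1 hθ.2.2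
  exact ⟨seqCons a θ, ⟨h, hja, hak⟩, cfVal_seqCons h.1⟩

/-- The value of `[0; 1, 3, 1, 3, …]`. -/
def topVal : ℝ := (Real.sqrt 21 - 3) / 2

theorem topVal_sq : topVal ^ 2 = 3 - 3 * topVal := by
  have := Real.sq_sqrt (show (0 : ℝ) ≤ 21 by norm_num)
  unfold topVal
  linear_combination this / 4

theorem topVal_gt : 0.7912 < topVal := by
  have : 4.5824 < Real.sqrt 21 := Real.lt_sqrt_of_sq_lt (by norm_num)
  unfold topVal
  linarith

theorem topVal_lt : topVal < 0.7913 := by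
  have : Real.sqrt 21 < 4.5826 := (Real.sqrt_lt' (by norm_num)).2 (by norm_num)
  unfold topVal
  linarith

theorem topVal_mem : topVal ∈ startVals 1 3 := by
  have hD : per13 ∈ Dset := by
    refine ⟨fun n => ?_, fun n => ?_⟩
    · unfold per13; split_ifs <;> simp
    · simp only [per13, badPairs, Set.mem_insert_iff, Set.mem_singleton_iff, Prod.mk.injEq]
      split_ifs <;> omega
  have hD' : (fun i => per13 (i + 1)) ∈ digitSeqs := digitSeqs_tail hD.1
  refine ⟨per13, ⟨hD, by simp [per13], by simp [per13]⟩, ?_⟩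
  have h1 := cfVal_eq hD.1
  have h2 := cfVal_eq hD'
  have h3 : (fun i => per13 (i + 1 + 1)) = per13 := by
    funext i
    simp only [per13]
    congr 1
    simp [Nat.add_assoc]
  simp only [h3] at h2
  rw [h2] at h1
  have h0 := (cfVal_mem_Icc hD.1).1
  simp only [per13, Nat.zero_mod, zero_add, if_true, Nat.cast_one] at h1
  norm_num at h1
  change cfVal per13 = _ at h1
  generalize cfVal per13 = v at *
  have h4 : v ^ 2 = 3 - 3 * v := by
    have : 3 + v ≠ 0 := by linarith
    have : 1 + (3 + v)⁻¹ ≠ 0 := by positivity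
    field_simp at h1
    linarith
  have h5 := topVal_sq
  have h6 := topVal_gt
  have : (v - topVal) * (v + topVal + 3) = 0 := by linear_combination h4 - h5
  rcases mul_eq_zero.1 this with h | h <;> linarith

theorem topVal_cube : topVal ^ 3 = 12 * topVal - 9 := by
  linear_combination (topVal - 3) * topVal_sq

theorem one_div_eq_of_mul {x y : ℝ} (h : x * y = 1) : 1 / x = y :=
  (eq_one_div_of_mul_eq_one_right h).symm

/-- The Möbius map `x ↦ (p + p' x) / (q + q' x)` of a finite continued fraction word. -/
structure CFMap where
  p : ℝ
  p' : ℝ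
  q : ℝ
  q' : ℝ
  q_pos : 0 < q
  q'_nonneg : 0 ≤ q'
  q'_le : q' ≤ q
  det_eq : p' * q - p * q' = 1 ∨ p' * q - p * q' = -1

namespace CFMap

/-- The value of a Möbius map at a point. -/
def eval (φ : CFMap) (x : ℝ) : ℝ := (φ.p + φ.p' * x) / (φ.q + φ.q' * x)

/-- The length of the image of the interval `[x, y]`. -/
def len (φ : CFMap) (x y : ℝ) : ℝ := (y - x) / ((φ.q + φ.q' * x) * (φ.q + φ.q' * y))

/-- The map of the word extended by the partial quotient `a`. -/
def snoc (φ : CFMap) (a : ℕ) (ha : 1 ≤ a) : CFMap where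
  p := φ.p * a + φ.p'
  p' := φ.p
  q := φ.q * a + φ.q'
  q' := φ.q
  q_pos := by
    have h1 := φ.q_pos
    have h2 := φ.q'_nonneg
    have h3 : (1 : ℝ) ≤ a := by exact_mod_cast ha
    positivity
  q'_nonneg := φ.q_pos.le
  q'_le := by
    have h1 := φ.q_pos
    have h2 := φ.q'_nonneg
    have h3 : (1 : ℝ) ≤ a := by exact_mod_cast ha
    nlinarith
  det_eq := by
    rcases φ.det_eq with h | h
    · right; linear_combination -h
    · left; linear_combination -h

theorem den_pos (φ : CFMap) {x : ℝ} (hx : 0 ≤ x) : 0 < φ.q + φ.q' * x := by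
  have := mul_nonneg φ.q'_nonneg hx
  linarith [φ.q_pos]

theorem eval_sub_of_den_ne_zero (φ : CFMap) {x y : ℝ} (hx : φ.q + φ.q' * x ≠ 0)
    (hy : φ.q + φ.q' * y ≠ 0) :
    φ.eval y - φ.eval x = (φ.p' * φ.q - φ.p * φ.q') * φ.len x y := by
  rw [eval, eval, len, div_sub_div _ _ hy hx, mul_div_assoc', mul_comm (φ.q + φ.q' * x)]
  congr 1
  ring

theorem eval_sub (φ : CFMap) {x y : ℝ} (hx : 0 ≤ x) (hy : 0 ≤ y) :
    φ.eval y - φ.eval x = (φ.p' * φ.q - φ.p * φ.q') * φ.len x y :=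
  φ.eval_sub_of_den_ne_zero (φ.den_pos hx).ne' (φ.den_pos hy).ne'

theorem len_nonneg (φ : CFMap) {x y : ℝ} (hx : 0 ≤ x) (hxy : x ≤ y) : 0 ≤ φ.len x y :=
  div_nonneg (sub_nonneg.2 hxy) (mul_pos (φ.den_pos hx) (φ.den_pos (hx.trans hxy))).le

theorem snoc_den (φ : CFMap) {a : ℕ} (ha : 1 ≤ a) {x : ℝ} (hx : 0 ≤ x) :
    (φ.snoc a ha).q + (φ.snoc a ha).q' * x = (a + x) * (φ.q + φ.q' * (1 / (a + x))) := by
  have h3 : (1 : ℝ) ≤ a := by exact_mod_cast ha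
  have h4 : (a : ℝ) + x ≠ 0 := by linarith
  simp only [snoc]
  field_simp
  ring

theorem eval_snoc (φ : CFMap) {a : ℕ} (ha : 1 ≤ a) {x : ℝ} (hx : 0 ≤ x) :
    (φ.snoc a ha).eval x = φ.eval (1 / (a + x)) := by
  have h3 : (1 : ℝ) ≤ a := by exact_mod_cast ha
  have h4 : 0 < (a : ℝ) + x := by linarith
  have h5 := (φ.den_pos (one_div_pos.2 h4).le).ne'
  have h6 : (φ.snoc a ha).p + (φ.snoc a ha).p' * x =
      (a + x) * (φ.p + φ.p' * (1 / (a + x))) := by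
    simp only [snoc]
    field_simp
    ring
  rw [eval, eval, snoc_den φ ha hx, h6, mul_div_mul_left _ _ h4.ne']

theorem len_snoc (φ : CFMap) {a : ℕ} (ha : 1 ≤ a) {x y : ℝ} (hx : 0 ≤ x) (hy : 0 ≤ y) :
    (φ.snoc a ha).len x y = φ.len (1 / (a + y)) (1 / (a + x)) := by
  have h3 : (1 : ℝ) ≤ a := by exact_mod_cast ha
  have h4 : 0 < (a : ℝ) + x := by linarith
  have h4' : 0 < (a : ℝ) + y := by linarith
  have h5 := (φ.den_pos (one_div_pos.2 h4).le).ne'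
  have h5' := (φ.den_pos (one_div_pos.2 h4').le).ne'
  have h6 : 1 / (a + x) - 1 / (a + y) = (y - x) / ((a + x) * (a + y)) := by
    field_simp
    ring
  rw [len, len, snoc_den φ ha hx, snoc_den φ ha hy, h6, div_div]
  congr 1
  ring

theorem continuousOn_eval (φ : CFMap) : ContinuousOn φ.eval (Ici 0) := by
  unfold eval
  exact ContinuousOn.div (by fun_prop) (by fun_prop) fun x hx => (φ.den_pos hx).ne'

/-- Compare the lengths of the images of two intervals. -/
theorem len_le_len (φ : CFMap) {x y z w : ℝ} (hx : 0 ≤ x) (hy : 0 ≤ y) (hz : 0 ≤ z) (hw : 0 ≤ w)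
    (h0 : y - x ≤ w - z)
    (h1 : (y - x) * (z + w) ≤ (w - z) * (x + y))
    (h2 : (y - x) * (z + w + z * w) ≤ (w - z) * (x + y + x * y)) :
    φ.len x y ≤ φ.len z w := by
  rw [len, len, div_le_div_iff₀ (mul_pos (φ.den_pos hx) (φ.den_pos hy))
    (mul_pos (φ.den_pos hz) (φ.den_pos hw))]
  have hq := φ.q_pos
  have hq' := φ.q'_nonneg
  have hle := φ.q'_le
  nlinarith [mul_nonneg (sub_nonneg.2 h0) (sq_nonneg φ.q),
    mul_nonneg (sub_nonneg.2 h1) (mul_nonneg hq' (sub_nonneg.2 hle)),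
    mul_nonneg (sub_nonneg.2 h2) (sq_nonneg φ.q')]

end CFMap

/-- The shapes of the intervals in the construction of the Cantor sets: `from j to k` stands for the
sequences whose next partial quotient lies between `j` and `k`. -/
inductive Cell
  | d14 | d13 | d24 | d23 | d34

namespace Cell

/-- The smallest admissible next partial quotient. -/
def first : Cell → ℕ
  | d14 => 1 | d13 => 1 | d24 => 2 | d23 => 2 | d34 => 3

/-- The largest admissible next partial quotient. -/
def last : Cell → ℕ
  | d14 => 4 | d13 => 3 | d24 => 4 | d23 => 3 | d34 => 4

/-- The left endpoint. -/
def x0 : Cell → ℝ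
  | d14 => 1 - topVal | d13 => topVal / 3 | d24 => 1 - topVal
  | d23 => topVal / 3 | d34 => 1 - topVal

/-- The left endpoint of the gap. -/
def x1 : Cell → ℝ
  | d14 => (3 - topVal) / 5 | d13 => (3 - topVal) / 5 | d24 => (7 + topVal) / 25
  | d23 => (7 + topVal) / 25 | d34 => (8 + topVal) / 37

/-- The right endpoint of the gap. -/
def x2 : Cell → ℝ
  | d14 => (2 + topVal) / 5 | d13 => (2 + topVal) / 5 | d24 => (1 + topVal) / 5
  | d23 => (1 + topVal) / 5 | d34 => topVal / 3

/-- The right endpoint. -/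
def x3 : Cell → ℝ
  | d14 => topVal | d13 => topVal | d24 => (3 - topVal) / 5
  | d23 => (3 - topVal) / 5 | d34 => (7 + topVal) / 25

theorem x0_nonneg (c : Cell) : 0 ≤ c.x0 := by
  have h1 := topVal_gt
  have h2 := topVal_lt
  cases c <;> simp only [x0] <;> linarith

theorem x0_lt_x1 (c : Cell) : c.x0 < c.x1 := by
  have h1 := topVal_gt
  have h2 := topVal_lt
  cases c <;> simp only [x0, x1] <;> linarith

theorem x1_lt_x2 (c : Cell) : c.x1 < c.x2 := by
  have h1 := topVal_gt
  have h2 := topVal_lt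
  cases c <;> simp only [x1, x2] <;> linarith

theorem x2_lt_x3 (c : Cell) : c.x2 < c.x3 := by
  have h1 := topVal_gt
  have h2 := topVal_lt
  cases c <;> simp only [x2, x3] <;> linarith

theorem x3_le_one (c : Cell) : c.x3 ≤ 1 := by
  have h1 := topVal_gt
  have h2 := topVal_lt
  cases c <;> simp only [x3] <;> linarith

theorem len_gap_le_left (c : Cell) (φ : CFMap) : φ.len c.x1 c.x2 ≤ φ.len c.x0 c.x1 := by
  have h1 := topVal_gt
  have h2 := topVal_lt
  have h3 := topVal_sq
  have h4 := topVal_cube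
  cases c <;> simp only [x0, x1, x2] <;> apply φ.len_le_len <;> linarith

theorem len_gap_le_right (c : Cell) (φ : CFMap) : φ.len c.x1 c.x2 ≤ φ.len c.x2 c.x3 := by
  have h1 := topVal_gt
  have h2 := topVal_lt
  have h3 := topVal_sq
  have h4 := topVal_cube
  cases c <;> simp only [x3, x1, x2] <;> apply φ.len_le_len <;> linarith

theorem gap_ge (c : Cell) : (c.x3 - c.x0) * 4 ≤ 30 * (c.x2 - c.x1) := by
  have h1 := topVal_gt
  have h2 := topVal_lt
  cases c <;> simp only [x0, x3, x1, x2] <;> linarith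

theorem first_pos (c : Cell) : 1 ≤ c.first := by cases c <;> simp [first]

theorem first_le_last (c : Cell) : c.first ≤ c.last := by cases c <;> simp [first, last]

theorem last_le (c : Cell) : c.last ≤ 4 := by cases c <;> simp [last]

end Cell

theorem topVal_mem' (a : ℕ) : topVal ∈ startVals 1 (maxNext a) :=
  startVals_mono le_rfl (by unfold maxNext; split_ifs <;> omega) topVal_mem

theorem third_topVal_mem : topVal / 3 ∈ startVals 1 3 := by
  have h := one_div_add_mem (j := 1) (k := 3) (a := 3) le_rfl (by norm_num) (by norm_num) le_rfl
    (topVal_mem' 3)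
  rwa [one_div_eq_of_mul (y := topVal / 3) (by push_cast; linarith [topVal_sq])] at h

theorem one_sub_topVal_mem : 1 - topVal ∈ startVals 1 4 := by
  have h := one_div_add_mem (j := 1) (k := 4) (a := 4) le_rfl (by norm_num) (by norm_num) le_rfl
    (topVal_mem' 4)
  rwa [one_div_eq_of_mul (y := 1 - topVal) (by push_cast; linarith [topVal_sq])] at h

theorem Cell.x0_mem (c : Cell) : c.x0 ∈ startVals c.first c.last := by
  have h := one_div_add_mem c.first_pos c.last_le c.first_le_last le_rfl (topVal_mem' c.last)
  have h3 := topVal_sq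
  rwa [one_div_eq_of_mul (y := c.x0)] at h
  cases c <;> simp only [last, x0] <;> push_cast <;> linarith

theorem Cell.x3_mem (c : Cell) : c.x3 ∈ startVals c.first c.last := by
  have key : ∀ v ∈ startVals 1 (maxNext c.first), (c.first + v) * c.x3 = 1 →
      c.x3 ∈ startVals c.first c.last := by
    intro v hv h1
    have h := one_div_add_mem c.first_pos c.last_le le_rfl c.first_le_last hv
    rwa [one_div_eq_of_mul h1] at h
  have h3 := topVal_sq
  cases c
  case d34 => exact key _ one_sub_topVal_mem (by simp only [first, x3]; push_cast; linarith)
  all_goals exact key _ third_topVal_mem (by simp only [first, x3]; push_cast; linarith)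

/-- A node of the construction: a word together with the shape of the interval of continuations. -/
abbrev CNode := CFMap × Cell

namespace CNode

/-- The left endpoint of the interval of a node. -/
def lo (n : CNode) : ℝ := min (n.1.eval n.2.x0) (n.1.eval n.2.x3)

/-- The right endpoint of the interval of a node. -/
def hi (n : CNode) : ℝ := max (n.1.eval n.2.x0) (n.1.eval n.2.x3)

/-- The length of the gap of a node. -/
def gap (n : CNode) : ℝ := n.1.len n.2.x1 n.2.x2

/-- The part of the Cantor set that lies in the interval of a node. -/
def pts (n : CNode) : Set ℝ := n.1.eval '' startVals n.2.first n.2.last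

theorem lo_mem (n : CNode) : lo n ∈ pts n := by
  rcases min_choice (n.1.eval n.2.x0) (n.1.eval n.2.x3) with h | h
  · exact ⟨_, n.2.x0_mem, h.symm⟩
  · exact ⟨_, n.2.x3_mem, h.symm⟩

theorem lo_le_hi (n : CNode) : lo n ≤ hi n := min_le_max

theorem isCompact_pts (n : CNode) : IsCompact (pts n) :=
  (isCompact_startVals _ _).image_of_continuousOn
    (n.1.continuousOn_eval.mono fun _ h => (startVals_subset_Icc _ _ h).1)

theorem hi_sub_lo (n : CNode) : hi n - lo n = n.1.len n.2.x0 n.2.x3 := by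
  obtain ⟨φ, c⟩ := n
  have h0 := c.x0_nonneg
  have h03 : c.x0 ≤ c.x3 := by linarith [c.x0_lt_x1, c.x1_lt_x2, c.x2_lt_x3]
  have h := φ.eval_sub h0 (h0.trans h03)
  have hl := φ.len_nonneg h0 h03
  simp only [hi, lo]
  rw [max_sub_min_eq_abs, h, abs_mul, abs_of_nonneg hl]
  rcases φ.det_eq with h | h <;> rw [h] <;> norm_num

/-- The interval of `n` splits into those of `n₀` and `n₁`. -/
theorem exists_split_of_children {n n₀ n₁ : CNode}
    (hlo₀ : lo n₀ = min (n.1.eval n.2.x0) (n.1.eval n.2.x1))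
    (hhi₀ : hi n₀ = max (n.1.eval n.2.x0) (n.1.eval n.2.x1))
    (hlo₁ : lo n₁ = min (n.1.eval n.2.x2) (n.1.eval n.2.x3))
    (hhi₁ : hi n₁ = max (n.1.eval n.2.x2) (n.1.eval n.2.x3))
    (hg₀ : gap n₀ ≤ gap n) (hg₁ : gap n₁ ≤ gap n) (hp₀ : pts n₀ ⊆ pts n) (hp₁ : pts n₁ ⊆ pts n) :
    ∃ l r, lo l = lo n ∧ hi r = hi n ∧ lo r - hi l = gap n ∧
      gap n ≤ hi l - lo l ∧ gap n ≤ hi r - lo r ∧ gap l ≤ gap n ∧ gap r ≤ gap n ∧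
      1 / 30 * (hi n - lo n) ≤ gap n ∧ pts l ⊆ pts n ∧ pts r ⊆ pts n := by
  obtain ⟨φ, c⟩ := n
  have hκ : 1 / 30 * (hi (φ, c) - lo (φ, c)) ≤ gap (φ, c) := by
    rw [hi_sub_lo]
    have h0 := c.x0_nonneg
    have h1 := c.x0_lt_x1
    have h2 := c.x1_lt_x2
    have h3 := c.x2_lt_x3
    have h4 := c.x3_le_one
    have h5 := c.gap_ge
    have hq := φ.q_pos
    have hq' := φ.q'_nonneg
    have hle := φ.q'_le
    have e : ∀ x, 0 ≤ x → x ≤ 1 → φ.q ≤ φ.q + φ.q' * x ∧ φ.q + φ.q' * x ≤ 2 * φ.q := by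
      intro x hx hx1
      constructor <;> nlinarith
    have ea := e c.x0 h0 (by linarith)
    have eb := e c.x1 (by linarith) (by linarith)
    have ec := e c.x2 (by linarith) (by linarith)
    have ed := e c.x3 (by linarith) (by linarith)
    have up : φ.len c.x0 c.x3 ≤ (c.x3 - c.x0) / φ.q ^ 2 := by
      rw [CFMap.len]
      gcongr
      · linarith
      · nlinarith
    have low : (c.x2 - c.x1) / (2 * φ.q) ^ 2 ≤ φ.len c.x1 c.x2 := by
      have : 0 < (φ.q + φ.q' * c.x1) * (φ.q + φ.q' * c.x2) :=
        mul_pos (by linarith) (by linarith)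
      rw [CFMap.len, sq]
      exact div_le_div_of_nonneg_left (by linarith) this
        (mul_le_mul eb.2 ec.2 (by linarith) (by linarith))
    refine le_trans ?_ low
    refine (mul_le_mul_of_nonneg_left up (by norm_num)).trans ?_
    rw [mul_div_assoc', div_le_div_iff₀ (by positivity) (by positivity)]
    nlinarith [mul_le_mul_of_nonneg_right h5 (sq_nonneg φ.q)]
  have h0 := c.x0_nonneg
  have h1 := c.x0_lt_x1
  have h2 := c.x1_lt_x2
  have h3 := c.x2_lt_x3
  have e1 := φ.eval_sub h0 (h0.trans h1.le)
  have e2 := φ.eval_sub (h0.trans h1.le) ((h0.trans h1.le).trans h2.le)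
  have e3 := φ.eval_sub ((h0.trans h1.le).trans h2.le) (((h0.trans h1.le).trans h2.le).trans h3.le)
  have p1 := φ.len_nonneg h0 h1.le
  have p2 := φ.len_nonneg (h0.trans h1.le) h2.le
  have p3 := φ.len_nonneg ((h0.trans h1.le).trans h2.le) h3.le
  have b1 := c.len_gap_le_left φ
  have b2 := c.len_gap_le_right φ
  have hgap : gap (φ, c) = φ.len c.x1 c.x2 := rfl
  have hlo : lo (φ, c) = min (φ.eval c.x0) (φ.eval c.x3) := rfl
  have hhi : hi (φ, c) = max (φ.eval c.x0) (φ.eval c.x3) := rfl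
  simp only at hlo₀ hhi₀ hlo₁ hhi₁
  rcases φ.det_eq with hd | hd
  · rw [hd] at e1 e2 e3
    rw [min_eq_left (by linarith)] at hlo hlo₀ hlo₁
    rw [max_eq_right (by linarith)] at hhi hhi₀ hhi₁
    exact ⟨n₀, n₁, by linarith, by linarith, by linarith, by linarith, by linarith, hg₀, hg₁, hκ,
      hp₀, hp₁⟩
  · rw [hd] at e1 e2 e3
    rw [min_eq_right (by linarith)] at hlo hlo₀ hlo₁
    rw [max_eq_left (by linarith)] at hhi hhi₀ hhi₁
    exact ⟨n₁, n₀, by linarith, by linarith, by linarith, by linarith, by linarith, hg₁, hg₀, hκ,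
      hp₁, hp₀⟩

theorem lo_snoc (φ : CFMap) {a : ℕ} (ha : 1 ≤ a) (c : Cell) {y z : ℝ} (hy : (a + c.x3) * y = 1)
    (hz : (a + c.x0) * z = 1) : lo (φ.snoc a ha, c) = min (φ.eval y) (φ.eval z) := by
  have h0 := c.x0_nonneg
  have h3 : 0 ≤ c.x3 := by linarith [c.x0_lt_x1, c.x1_lt_x2, c.x2_lt_x3]
  simp only [lo]
  rw [φ.eval_snoc ha h0, φ.eval_snoc ha h3, one_div_eq_of_mul hy, one_div_eq_of_mul hz, min_comm]

theorem hi_snoc (φ : CFMap) {a : ℕ} (ha : 1 ≤ a) (c : Cell) {y z : ℝ} (hy : (a + c.x3) * y = 1)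
    (hz : (a + c.x0) * z = 1) : hi (φ.snoc a ha, c) = max (φ.eval y) (φ.eval z) := by
  have h0 := c.x0_nonneg
  have h3 : 0 ≤ c.x3 := by linarith [c.x0_lt_x1, c.x1_lt_x2, c.x2_lt_x3]
  simp only [hi]
  rw [φ.eval_snoc ha h0, φ.eval_snoc ha h3, one_div_eq_of_mul hy, one_div_eq_of_mul hz, max_comm]

theorem gap_snoc (φ : CFMap) {a : ℕ} (ha : 1 ≤ a) (c : Cell) {y z : ℝ} (hy : (a + c.x2) * y = 1)
    (hz : (a + c.x1) * z = 1) : gap (φ.snoc a ha, c) = φ.len y z := by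
  have h1 : 0 ≤ c.x1 := by linarith [c.x0_nonneg, c.x0_lt_x1]
  have h2 : 0 ≤ c.x2 := by linarith [c.x1_lt_x2]
  simp only [gap]
  rw [φ.len_snoc ha h1 h2, one_div_eq_of_mul hy, one_div_eq_of_mul hz]

theorem pts_snoc_subset (φ : CFMap) {a : ℕ} (ha : 1 ≤ a) (c d : Cell) (hc : c.last ≤ maxNext a)
    (h1 : d.first ≤ a) (h2 : a ≤ d.last) : pts (φ.snoc a ha, c) ⊆ pts (φ, d) := by
  rintro _ ⟨v, hv, rfl⟩
  have hv' := startVals_mono c.first_pos hc hv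
  rw [φ.eval_snoc ha (startVals_subset_Icc _ _ hv).1]
  exact ⟨_, one_div_add_mem d.first_pos d.last_le h1 h2 hv', rfl⟩

theorem pts_mono (φ : CFMap) {c d : Cell} (h1 : d.first ≤ c.first) (h2 : c.last ≤ d.last) :
    pts (φ, c) ⊆ pts (φ, d) :=
  image_mono (startVals_mono h1 h2)

theorem exists_split (n : CNode) :
    ∃ l r, lo l = lo n ∧ hi r = hi n ∧ lo r - hi l = gap n ∧
      gap n ≤ hi l - lo l ∧ gap n ≤ hi r - lo r ∧ gap l ≤ gap n ∧ gap r ≤ gap n ∧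
      1 / 30 * (hi n - lo n) ≤ gap n ∧ pts l ⊆ pts n ∧ pts r ⊆ pts n := by
  have h1 := topVal_gt
  have h2 := topVal_lt
  have h3 := topVal_sq
  have h4 := topVal_cube
  obtain ⟨φ, c⟩ := n
  cases c
  case d14 =>
    refine exists_split_of_children (n₀ := (φ, .d24))
      (n₁ := (φ.snoc 1 (by norm_num), .d13)) ?_ ?_ ?_ ?_ ?_ ?_ ?_ ?_
    · rfl
    · rfl
    · apply lo_snoc <;> simp only [Cell.x0, Cell.x2, Cell.x3] <;> push_cast <;> linarith
    · apply hi_snoc <;> simp only [Cell.x0, Cell.x2, Cell.x3] <;> push_cast <;> linarith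
    · simp only [gap, Cell.x1, Cell.x2]
      apply φ.len_le_len <;> linarith
    · rw [gap_snoc _ _ _ (y := (4 - topVal) / 5) (z := (11 + topVal) / 17)
        (by simp only [Cell.x2]; push_cast; linarith)
        (by simp only [Cell.x1]; push_cast; linarith)]
      simp only [gap, Cell.x1, Cell.x2]
      apply φ.len_le_len <;> linarith
    · exact pts_mono _ (by decide) (by decide)
    · exact pts_snoc_subset _ _ _ _ (by decide) (by decide) (by decide)
  case d13 =>
    refine exists_split_of_children (n₀ := (φ, .d23))
      (n₁ := (φ.snoc 1 (by norm_num), .d13)) ?_ ?_ ?_ ?_ ?_ ?_ ?_ ?_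
    · rfl
    · rfl
    · apply lo_snoc <;> simp only [Cell.x0, Cell.x2, Cell.x3] <;> push_cast <;> linarith
    · apply hi_snoc <;> simp only [Cell.x0, Cell.x2, Cell.x3] <;> push_cast <;> linarith
    · simp only [gap, Cell.x1, Cell.x2]
      apply φ.len_le_len <;> linarith
    · rw [gap_snoc _ _ _ (y := (4 - topVal) / 5) (z := (11 + topVal) / 17)
        (by simp only [Cell.x2]; push_cast; linarith)
        (by simp only [Cell.x1]; push_cast; linarith)]
      simp only [gap, Cell.x1, Cell.x2]
      apply φ.len_le_len <;> linarith
    · exact pts_mono _ (by decide) (by decide)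
    · exact pts_snoc_subset _ _ _ _ (by decide) (by decide) (by decide)
  case d24 =>
    refine exists_split_of_children (n₀ := (φ, .d34))
      (n₁ := (φ.snoc 2 (by norm_num), .d13)) ?_ ?_ ?_ ?_ ?_ ?_ ?_ ?_
    · rfl
    · rfl
    · apply lo_snoc <;> simp only [Cell.x0, Cell.x2, Cell.x3] <;> push_cast <;> linarith
    · apply hi_snoc <;> simp only [Cell.x0, Cell.x2, Cell.x3] <;> push_cast <;> linarith
    · simp only [gap, Cell.x1, Cell.x2]
      apply φ.len_le_len <;> linarith
    · rw [gap_snoc _ _ _ (y := (9 - topVal) / 21) (z := (16 + topVal) / 41)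
        (by simp only [Cell.x2]; push_cast; linarith)
        (by simp only [Cell.x1]; push_cast; linarith)]
      simp only [gap, Cell.x1, Cell.x2]
      apply φ.len_le_len <;> linarith
    · exact pts_mono _ (by decide) (by decide)
    · exact pts_snoc_subset _ _ _ _ (by decide) (by decide) (by decide)
  case d23 =>
    refine exists_split_of_children (n₀ := (φ.snoc 3 (by norm_num), .d14))
      (n₁ := (φ.snoc 2 (by norm_num), .d13)) ?_ ?_ ?_ ?_ ?_ ?_ ?_ ?_
    · apply lo_snoc <;> simp only [Cell.x0, Cell.x1, Cell.x3] <;> push_cast <;> linarith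
    · apply hi_snoc <;> simp only [Cell.x0, Cell.x1, Cell.x3] <;> push_cast <;> linarith
    · apply lo_snoc <;> simp only [Cell.x0, Cell.x2, Cell.x3] <;> push_cast <;> linarith
    · apply hi_snoc <;> simp only [Cell.x0, Cell.x2, Cell.x3] <;> push_cast <;> linarith
    · rw [gap_snoc _ _ _ (y := (14 - topVal) / 47) (z := (21 + topVal) / 75)
        (by simp only [Cell.x2]; push_cast; linarith)
        (by simp only [Cell.x1]; push_cast; linarith)]
      simp only [gap, Cell.x1, Cell.x2]
      apply φ.len_le_len <;> linarith
    · rw [gap_snoc _ _ _ (y := (9 - topVal) / 21) (z := (16 + topVal) / 41)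
        (by simp only [Cell.x2]; push_cast; linarith)
        (by simp only [Cell.x1]; push_cast; linarith)]
      simp only [gap, Cell.x1, Cell.x2]
      apply φ.len_le_len <;> linarith
    · exact pts_snoc_subset _ _ _ _ (by decide) (by decide) (by decide)
    · exact pts_snoc_subset _ _ _ _ (by decide) (by decide) (by decide)
  case d34 =>
    refine exists_split_of_children (n₀ := (φ.snoc 4 (by norm_num), .d14))
      (n₁ := (φ.snoc 3 (by norm_num), .d14)) ?_ ?_ ?_ ?_ ?_ ?_ ?_ ?_
    · apply lo_snoc <;> simp only [Cell.x0, Cell.x1, Cell.x3] <;> push_cast <;> linarith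
    · apply hi_snoc <;> simp only [Cell.x0, Cell.x1, Cell.x3] <;> push_cast <;> linarith
    · apply lo_snoc <;> simp only [Cell.x0, Cell.x2, Cell.x3] <;> push_cast <;> linarith
    · apply hi_snoc <;> simp only [Cell.x0, Cell.x2, Cell.x3] <;> push_cast <;> linarith
    · rw [gap_snoc _ _ _ (y := (19 - topVal) / 83) (z := (26 + topVal) / 119)
        (by simp only [Cell.x2]; push_cast; linarith)
        (by simp only [Cell.x1]; push_cast; linarith)]
      simp only [gap, Cell.x1, Cell.x2]
      apply φ.len_le_len <;> linarith
    · rw [gap_snoc _ _ _ (y := (14 - topVal) / 47) (z := (21 + topVal) / 75)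
        (by simp only [Cell.x2]; push_cast; linarith)
        (by simp only [Cell.x1]; push_cast; linarith)]
      simp only [gap, Cell.x1, Cell.x2]
      apply φ.len_le_len <;> linarith
    · exact pts_snoc_subset _ _ _ _ (by decide) (by decide) (by decide)
    · exact pts_snoc_subset _ _ _ _ (by decide) (by decide) (by decide)

theorem Icc_subset_add {i j : CNode} (hij : gap i ≤ hi j - lo j) (hji : gap j ≤ hi i - lo i) :
    Icc (lo i + lo j) (hi i + hi j) ⊆ pts i + pts j := fun _ hx =>
  mem_add_of_split lo hi gap pts (by norm_num : (0 : ℝ) < 1 / 30) (by norm_num) lo_mem lo_le_hi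
    exists_split hij hji ((isCompact_pts i).add (isCompact_pts j)).isClosed hx

theorem lo_of_det {φ : CFMap} (h : φ.p' * φ.q - φ.p * φ.q' = 1) (c : Cell) :
    lo (φ, c) = φ.eval c.x0 := by
  have h0 := c.x0_nonneg
  have h3 : c.x0 ≤ c.x3 := by linarith [c.x0_lt_x1, c.x1_lt_x2, c.x2_lt_x3]
  have h1 := φ.eval_sub h0 (h0.trans h3)
  have h2 := φ.len_nonneg h0 h3
  exact min_eq_left (by rw [h] at h1; linarith)

theorem hi_of_det {φ : CFMap} (h : φ.p' * φ.q - φ.p * φ.q' = 1) (c : Cell) :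
    hi (φ, c) = φ.eval c.x3 := by
  have h1 := lo_of_det h c
  simp only [lo, hi] at *
  linarith [min_add_max (φ.eval c.x0) (φ.eval c.x3)]

theorem snoc_snoc_det {φ : CFMap} (h : φ.p' * φ.q - φ.p * φ.q' = 1) {a b : ℕ} (ha : 1 ≤ a)
    (hb : 1 ≤ b) : ((φ.snoc a ha).snoc b hb).p' * ((φ.snoc a ha).snoc b hb).q -
      ((φ.snoc a ha).snoc b hb).p * ((φ.snoc a ha).snoc b hb).q' = 1 := by
  simp only [CFMap.snoc]
  linear_combination h

end CNode

theorem CFMap.eval_snoc_snoc (φ : CFMap) {a b : ℕ} (ha : 1 ≤ a) (hb : 1 ≤ b) {x y z : ℝ}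
    (hx : 0 ≤ x) (hy : (b + x) * y = 1) (hz : (a + y) * z = 1) :
    ((φ.snoc a ha).snoc b hb).eval x = φ.eval z := by
  have hb' : (1 : ℝ) ≤ b := by exact_mod_cast hb
  rw [CFMap.eval_snoc _ _ hx, one_div_eq_of_mul hy, CFMap.eval_snoc, one_div_eq_of_mul hz]
  by_contra h
  nlinarith

/-- `ψ` is the precomposition of `φ` with `x ↦ x - 1`, and `φ` is increasing and close to linear. -/
structure IsShift (φ ψ : CFMap) : Prop where
  p_eq : ψ.p = φ.p - φ.p'
  p'_eq : ψ.p' = φ.p'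
  q_eq : ψ.q = φ.q - φ.q'
  q'_eq : ψ.q' = φ.q'
  le : 24 * φ.q' ≤ 5 * φ.q
  det : φ.p' * φ.q - φ.p * φ.q' = 1

namespace IsShift

variable {φ ψ : CFMap}

theorem eval_eq (h : IsShift φ ψ) (x : ℝ) : ψ.eval x = φ.eval (x - 1) := by
  rw [CFMap.eval, CFMap.eval, h.p_eq, h.p'_eq, h.q_eq, h.q'_eq]
  ring_nf

theorem len_eq (h : IsShift φ ψ) (x y : ℝ) : ψ.len x y = φ.len (x - 1) (y - 1) := by
  rw [CFMap.len, CFMap.len, h.q_eq, h.q'_eq]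
  ring_nf

theorem det_right (h : IsShift φ ψ) : ψ.p' * ψ.q - ψ.p * ψ.q' = 1 := by
  rw [h.p_eq, h.p'_eq, h.q_eq, h.q'_eq]
  linear_combination h.det

theorem den_pos (h : IsShift φ ψ) {x : ℝ} (hx : -1 ≤ x) : 0 < φ.q + φ.q' * x := by
  have h1 := φ.q_pos
  have h2 := φ.q'_nonneg
  have h3 := h.le
  nlinarith

theorem sub_eq_len (h : IsShift φ ψ) {x y : ℝ} (hx : -1 ≤ x) (hy : -1 ≤ y) :
    φ.eval y - φ.eval x = φ.len x y := by
  rw [φ.eval_sub_of_den_ne_zero (h.den_pos hx).ne' (h.den_pos hy).ne', h.det, one_mul]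

theorem len_le_len (h : IsShift φ ψ) {x y z w : ℝ} (hx : -1 ≤ x) (hy : -1 ≤ y) (hz : -1 ≤ z)
    (hw : -1 ≤ w) (h0 : y - x ≤ w - z)
    (h1 : (y - x) * (48 + 5 * (z + w)) ≤ (w - z) * (48 + 5 * (x + y)))
    (h2 : (y - x) * ((24 + 5 * z) * (24 + 5 * w)) ≤ (w - z) * ((24 + 5 * x) * (24 + 5 * y))) :
    φ.len x y ≤ φ.len z w := by
  rw [CFMap.len, CFMap.len, div_le_div_iff₀ (mul_pos (h.den_pos hx) (h.den_pos hy))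
    (mul_pos (h.den_pos hz) (h.den_pos hw))]
  have hr : 0 ≤ 5 * φ.q - 24 * φ.q' := by linarith [h.le]
  have hq' := φ.q'_nonneg
  have e0 := mul_nonneg (sub_nonneg.2 h0) (sq_nonneg (5 * φ.q - 24 * φ.q'))
  have e1 := mul_nonneg (sub_nonneg.2 h1) (mul_nonneg hr hq')
  have e2 := mul_nonneg (sub_nonneg.2 h2) (sq_nonneg φ.q')
  linarith

open CNode

theorem Icc_subset_add_self (h : IsShift φ ψ) :
    Icc (2 * φ.eval (1 - topVal)) (2 * φ.eval topVal) ⊆ pts (φ, .d14) + pts (φ, .d14) := by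
  have h1 : gap (φ, .d14) ≤ hi (φ, .d14) - lo (φ, .d14) := by
    obtain ⟨l, r, e1, e2, e3, e4, e5, -⟩ := exists_split (φ, .d14)
    linarith [lo_le_hi l, lo_le_hi r]
  have := Icc_subset_add h1 h1
  rwa [lo_of_det h.det, hi_of_det h.det, ← two_mul, ← two_mul] at this

theorem Icc_subset_union (h : IsShift φ ψ) :
    Icc (φ.eval (1 - topVal) + ψ.eval (1 - topVal)) (φ.eval ((3 - topVal) / 3) + ψ.eval topVal) ⊆
      (pts (φ, .d24) + pts (ψ, .d14)) ∪
      (pts ((φ.snoc 1 le_rfl).snoc 1 le_rfl, .d13) + pts (ψ.snoc 1 le_rfl, .d13)) ∪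
      (pts ((φ.snoc 1 le_rfl).snoc 2 one_le_two, .d13) + pts (ψ.snoc 1 le_rfl, .d23)) := by
  have t1 := topVal_gt
  have t2 := topVal_lt
  have t3 := topVal_sq
  have t4 := topVal_cube
  have c1 := Icc_subset_add (i := (φ, .d24)) (j := (ψ, .d14))
    (by
      rw [hi_sub_lo, gap, h.len_eq]
      simp only [Cell.x0, Cell.x1, Cell.x2, Cell.x3]
      apply h.len_le_len <;> linarith)
    (by
      rw [hi_sub_lo, gap, h.len_eq]
      simp only [Cell.x0, Cell.x1, Cell.x2, Cell.x3]
      apply h.len_le_len <;> linarith)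
  have l1 : lo ((φ.snoc 1 le_rfl).snoc 1 le_rfl, .d13) = φ.eval ((2 + topVal) / 5) := by
    rw [lo_of_det (snoc_snoc_det h.det _ _)]
    simp only [Cell.x0]
    apply CFMap.eval_snoc_snoc (y := topVal) <;> push_cast <;> linarith
  have r1 : hi ((φ.snoc 1 le_rfl).snoc 1 le_rfl, .d13) = φ.eval ((4 - topVal) / 5) := by
    rw [hi_of_det (snoc_snoc_det h.det _ _)]
    simp only [Cell.x3]
    apply CFMap.eval_snoc_snoc (y := (2 + topVal) / 5) <;> push_cast <;> linarith
  have l2 : lo ((φ.snoc 1 le_rfl).snoc 2 one_le_two, .d13) = φ.eval ((11 + topVal) / 17) := by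
    rw [lo_of_det (snoc_snoc_det h.det _ _)]
    simp only [Cell.x0]
    apply CFMap.eval_snoc_snoc (y := (3 - topVal) / 5) <;> push_cast <;> linarith
  have r2 : hi ((φ.snoc 1 le_rfl).snoc 2 one_le_two, .d13) = φ.eval ((3 - topVal) / 3) := by
    rw [hi_of_det (snoc_snoc_det h.det _ _)]
    simp only [Cell.x3]
    apply CFMap.eval_snoc_snoc (y := (1 + topVal) / 5) <;> push_cast <;> linarith
  have ψ_mono : ∀ {x y : ℝ}, 0 ≤ x → x ≤ y → ψ.eval x ≤ ψ.eval y := by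
    intro x y hx hxy
    have e := ψ.eval_sub hx (hx.trans hxy)
    rw [h.det_right, one_mul] at e
    linarith [ψ.len_nonneg hx hxy]
  have l3 : lo (ψ.snoc 1 le_rfl, .d13) = ψ.eval ((2 + topVal) / 5) := by
    rw [lo_snoc (y := (2 + topVal) / 5) (z := topVal), min_eq_left]
    · apply ψ_mono <;> linarith
    all_goals simp only [Cell.x0, Cell.x3]; push_cast; linarith
  have r3 : hi (ψ.snoc 1 le_rfl, .d13) = ψ.eval topVal := by
    rw [hi_snoc (y := (2 + topVal) / 5) (z := topVal), max_eq_right]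
    · apply ψ_mono <;> linarith
    all_goals simp only [Cell.x0, Cell.x3]; push_cast; linarith
  have l4 : lo (ψ.snoc 1 le_rfl, .d23) = ψ.eval ((11 + topVal) / 17) := by
    rw [lo_snoc (y := (11 + topVal) / 17) (z := topVal), min_eq_left]
    · apply ψ_mono <;> linarith
    all_goals simp only [Cell.x0, Cell.x3]; push_cast; linarith
  have r4 : hi (ψ.snoc 1 le_rfl, .d23) = ψ.eval topVal := by
    rw [hi_snoc (y := (11 + topVal) / 17) (z := topVal), max_eq_right]
    · apply ψ_mono <;> linarith
    all_goals simp only [Cell.x0, Cell.x3]; push_cast; linarith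
  have g1 : gap ((φ.snoc 1 le_rfl).snoc 1 le_rfl, .d13) =
      φ.len ((25 - topVal) / 41) ((12 + topVal) / 21) := by
    rw [gap_snoc _ _ _ (y := (4 - topVal) / 5) (z := (11 + topVal) / 17), CFMap.len_snoc,
      one_div_eq_of_mul (y := (25 - topVal) / 41), one_div_eq_of_mul (y := (12 + topVal) / 21)]
    all_goals (try simp only [Cell.x1, Cell.x2]); push_cast; linarith
  have g2 : gap ((φ.snoc 1 le_rfl).snoc 2 one_le_two, .d13) =
      φ.len ((54 - topVal) / 75) ((33 + topVal) / 47) := by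
    rw [gap_snoc _ _ _ (y := (9 - topVal) / 21) (z := (16 + topVal) / 41), CFMap.len_snoc,
      one_div_eq_of_mul (y := (54 - topVal) / 75), one_div_eq_of_mul (y := (33 + topVal) / 47)]
    all_goals (try simp only [Cell.x1, Cell.x2]); push_cast; linarith
  have g3 : gap (ψ.snoc 1 le_rfl, .d13) = ψ.len ((4 - topVal) / 5) ((11 + topVal) / 17) := by
    rw [gap_snoc _ _ _ (y := (4 - topVal) / 5) (z := (11 + topVal) / 17)]
    all_goals simp only [Cell.x1, Cell.x2]; push_cast; linarith
  have g4 : gap (ψ.snoc 1 le_rfl, .d23) = ψ.len ((3 - topVal) / 3) ((29 - topVal) / 37) := by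
    rw [gap_snoc _ _ _ (y := (3 - topVal) / 3) (z := (29 - topVal) / 37)]
    all_goals simp only [Cell.x1, Cell.x2]; push_cast; linarith
  have sφ : ∀ {x y : ℝ}, 0 ≤ x → 0 ≤ y → φ.eval y - φ.eval x = φ.len x y := fun hx hy =>
    h.sub_eq_len (by linarith) (by linarith)
  have sψ : ∀ {x y : ℝ}, 0 ≤ x → 0 ≤ y → ψ.eval y - ψ.eval x = φ.len (x - 1) (y - 1) := by
    intro x y hx hy
    rw [h.eval_eq, h.eval_eq]
    exact h.sub_eq_len (by linarith) (by linarith)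
  have c2 := Icc_subset_add (i := ((φ.snoc 1 le_rfl).snoc 1 le_rfl, .d13))
    (j := (ψ.snoc 1 le_rfl, .d13))
    (by
      rw [g1, l3, r3, sψ (by linarith) (by linarith)]
      apply h.len_le_len <;> linarith)
    (by
      rw [g3, l1, r1, sφ (by linarith) (by linarith), h.len_eq]
      apply h.len_le_len <;> linarith)
  have c3 := Icc_subset_add (i := ((φ.snoc 1 le_rfl).snoc 2 one_le_two, .d13))
    (j := (ψ.snoc 1 le_rfl, .d23))
    (by
      rw [g2, l4, r4, sψ (by linarith) (by linarith)]
      apply h.len_le_len <;> linarith)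
    (by
      rw [g4, l2, r2, sφ (by linarith) (by linarith), h.len_eq]
      apply h.len_le_len <;> linarith)
  have j1 : φ.len ((3 - topVal) / 5) ((2 + topVal) / 5) ≤
      φ.len ((2 + topVal) / 5 - 1) (topVal - 1) := by
    apply h.len_le_len <;> linarith
  have j2 : φ.len ((4 - topVal) / 5) ((11 + topVal) / 17) ≤
      φ.len ((11 + topVal) / 17 - 1) (topVal - 1) := by
    apply h.len_le_len <;> linarith
  rw [← sφ (by linarith) (by linarith), ← sψ (by linarith) (by linarith)] at j1 j2
  rw [l1, l3, r1, r3] at c2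
  rw [l2, l4, r2, r4] at c3
  rw [lo_of_det h.det, lo_of_det h.det_right, hi_of_det h.det, hi_of_det h.det_right] at c1
  simp only [Cell.x0, Cell.x3] at c1
  intro x hx
  by_cases hx1 : x ≤ φ.eval ((3 - topVal) / 5) + ψ.eval topVal
  · exact Or.inl (Or.inl (c1 ⟨hx.1, hx1⟩))
  · by_cases hx2 : x ≤ φ.eval ((4 - topVal) / 5) + ψ.eval topVal
    · exact Or.inl (Or.inr (c2 ⟨by linarith, hx2⟩))
    · exact Or.inr (c3 ⟨by linarith, hx.2⟩)

theorem two_mul_eval_le (h : IsShift φ ψ) :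
    2 * φ.eval (1 - topVal) ≤ φ.eval ((3 - topVal) / 3) + ψ.eval topVal := by
  have t1 := topVal_gt
  have t2 := topVal_lt
  have t3 := topVal_sq
  have t4 := topVal_cube
  have : φ.len (topVal - 1) (1 - topVal) ≤ φ.len (1 - topVal) ((3 - topVal) / 3) := by
    apply h.len_le_len <;> linarith
  rw [← h.sub_eq_len (by linarith) (by linarith), ← h.sub_eq_len (by linarith) (by linarith)] at this
  rw [h.eval_eq topVal]
  linarith

end IsShift

theorem app_append_pair (w : List ℕ) (a b : ℕ) (θ : ℕ → ℕ) :
    app (w ++ [a, b]) θ = app w (seqCons a (seqCons b θ)) := by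
  funext n
  simp only [app, List.length_append, List.length_cons, List.length_nil, List.get_eq_getElem]
  by_cases h : n < w.length
  · rw [dif_pos h, dif_pos (by omega), List.getElem_append_left h]
  · obtain ⟨k, rfl⟩ := Nat.exists_eq_add_of_le (not_lt.1 h)
    rw [dif_neg h, Nat.add_sub_cancel_left]
    rcases k with _ | _ | k
    · rw [dif_pos (by omega), List.getElem_append_right (by omega)]
      simp [seqCons]
    · rw [dif_pos (by omega), List.getElem_append_right (by omega)]
      simp [seqCons]
    · rw [dif_neg (by omega), show w.length + (k + 1 + 1) - (w.length + (0 + 1 + 1)) = k by omega]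
      rfl

theorem bW_succ (s : ℕ) : bW (s + 1) = bW s ++ [1, 4] := by
  simp [bW, List.replicate_succ']

theorem cfVal_seqCons_seqCons {a b : ℕ} (ha : a ∈ ({1, 2, 3, 4} : Set ℕ))
    (hb : b ∈ ({1, 2, 3, 4} : Set ℕ)) {θ : ℕ → ℕ} (h : θ ∈ digitSeqs) :
    seqCons a (seqCons b θ) ∈ digitSeqs ∧
      cfVal (seqCons a (seqCons b θ)) = 1 / (a + 1 / (b + cfVal θ)) := by
  have cons_mem : ∀ {a : ℕ} {θ : ℕ → ℕ}, a ∈ ({1, 2, 3, 4} : Set ℕ) → θ ∈ digitSeqs →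
      seqCons a θ ∈ digitSeqs := by
    intro a θ ha h n
    cases n with
    | zero => exact ha
    | succ n => exact h n
  have hb' := cons_mem hb h
  have ha' := cons_mem ha hb'
  exact ⟨ha', by rw [cfVal_seqCons ha', cfVal_seqCons hb']⟩

theorem CFMap.eval_snoc_snoc_cfVal (φ : CFMap) {a b : ℕ} (ha : 1 ≤ a) (hb : 1 ≤ b)
    (ha4 : a ≤ 4) (hb4 : b ≤ 4) {θ : ℕ → ℕ} (h : θ ∈ digitSeqs) :
    seqCons a (seqCons b θ) ∈ digitSeqs ∧
      ((φ.snoc a ha).snoc b hb).eval (cfVal θ) = φ.eval (cfVal (seqCons a (seqCons b θ))) := by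
  have key := cfVal_seqCons_seqCons (a := a) (b := b)
    (by simp only [Set.mem_insert_iff, Set.mem_singleton_iff]; omega)
    (by simp only [Set.mem_insert_iff, Set.mem_singleton_iff]; omega) h
  have h0 := (cfVal_mem_Icc h).1
  have hb' : (1 : ℝ) ≤ b := by exact_mod_cast hb
  rw [CFMap.eval_snoc _ _ h0, CFMap.eval_snoc _ _ (by positivity), key.2]
  exact ⟨key.1, rfl⟩

/-- The map of the word `bW s`. -/
def bMap : ℕ → CFMap
  | 0 => ⟨0, 1, 1, 0, one_pos, le_rfl, zero_le_one, Or.inl (by norm_num)⟩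
  | s + 1 => ((bMap s).snoc 1 le_rfl).snoc 4 (by norm_num)

/-- The map of the word `cW (s + 1)`. -/
def cMap (s : ℕ) : CFMap := ((bMap s).snoc 1 le_rfl).snoc 3 (by norm_num)

theorem cfVal_app_bW (s : ℕ) {θ : ℕ → ℕ} (h : θ ∈ digitSeqs) :
    cfVal (app (bW s) θ) = (bMap s).eval (cfVal θ) := by
  induction s generalizing θ with
  | zero =>
    have : app (bW 0) θ = θ := by
      funext n
      simp [app, bW]
    simp [this, bMap, CFMap.eval]
  | succ s ih =>
    have key := (bMap s).eval_snoc_snoc_cfVal (a := 1) (b := 4) le_rfl (by norm_num) (by norm_num)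
      le_rfl h
    rw [bW_succ, app_append_pair, ih key.1, bMap, key.2]

theorem cfVal_app_cW (s : ℕ) {θ : ℕ → ℕ} (h : θ ∈ digitSeqs) :
    cfVal (app (cW (s + 1)) θ) = (cMap s).eval (cfVal θ) := by
  have key := (bMap s).eval_snoc_snoc_cfVal (a := 1) (b := 3) le_rfl (by norm_num) (by norm_num)
    (by norm_num) h
  rw [cW, Nat.add_sub_cancel, app_append_pair, cfVal_app_bW s key.1, cMap, key.2]

theorem bMap_det (s : ℕ) : (bMap s).p' * (bMap s).q - (bMap s).p * (bMap s).q' = 1 := by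
  induction s with
  | zero => simp [bMap]
  | succ s ih => exact CNode.snoc_snoc_det ih _ _

theorem bMap_q (s : ℕ) : (s : ℝ) + 1 ≤ (bMap s).q ∧ 24 * (bMap s).q' ≤ 5 * (bMap s).q := by
  induction s with
  | zero => simp [bMap]
  | succ s ih =>
    have h1 := (bMap s).q'_nonneg
    have h2 := (bMap s).q_pos
    simp only [bMap, CFMap.snoc]
    push_cast
    constructor <;> linarith

theorem isShift (s : ℕ) : IsShift (bMap (s + 1)) (cMap s) where
  p_eq := by
    simp only [bMap, cMap, CFMap.snoc]
    push_cast
    ring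
  p'_eq := rfl
  q_eq := by
    simp only [bMap, cMap, CFMap.snoc]
    push_cast
    ring
  q'_eq := rfl
  le := (bMap_q (s + 1)).2
  det := bMap_det (s + 1)

open CNode

theorem pair_notMem_badPairs {d e : ℕ} (hd : 3 ≤ d) : (d, e) ∉ badPairs := by
  simp only [badPairs, Set.mem_insert_iff, Set.mem_singleton_iff, Prod.mk.injEq]
  omega

theorem getLast?_bW_succ (s d : ℕ) (h : (bW (s + 1)).getLast? = some d) : 3 ≤ d := by
  rw [bW_succ] at h
  simp at h
  omega

theorem getLast?_cW_succ (s d : ℕ) (h : (cW (s + 1)).getLast? = some d) : 3 ≤ d := by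
  rw [cW] at h
  simp at h
  omega

theorem pts_bMap_subset_Kb (s : ℕ) : pts (bMap (s + 1), .d14) ⊆ Kb (bW (s + 1)) := by
  rintro _ ⟨_, ⟨θ, hθ, rfl⟩, rfl⟩
  exact ⟨θ, hθ.1, fun d hd => pair_notMem_badPairs (getLast?_bW_succ s d hd),
    (cfVal_app_bW _ hθ.1.1).symm⟩

theorem pts_cMap_subset_Kb (s : ℕ) : pts (cMap s, .d14) ⊆ Kb (cW (s + 1)) := by
  rintro _ ⟨_, ⟨θ, hθ, rfl⟩, rfl⟩
  exact ⟨θ, hθ.1, fun d hd => pair_notMem_badPairs (getLast?_cW_succ s d hd),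
    (cfVal_app_cW _ hθ.1.1).symm⟩

theorem pts_bMap_subset_Ktil (s : ℕ) : pts (bMap (s + 1), .d24) ⊆ Ktil (bW (s + 1)) := by
  rintro _ ⟨_, ⟨θ, hθ, rfl⟩, rfl⟩
  refine ⟨θ, hθ.1, fun d hd => pair_notMem_badPairs (getLast?_bW_succ s d hd), fun h => ?_,
    (cfVal_app_bW _ hθ.1.1).symm⟩
  have h1 : 2 ≤ θ 0 := hθ.2.1
  rw [Prod.mk.injEq] at h
  omega

theorem pts_snoc_snoc_subset_Ktil (s : ℕ) {a : ℕ} (ha : 1 ≤ a) (ha2 : a ≤ 2) :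
    pts (((bMap (s + 1)).snoc 1 le_rfl).snoc a ha, .d13) ⊆ Ktil (bW (s + 1)) := by
  rintro _ ⟨_, ⟨θ, hθ, rfl⟩, rfl⟩
  have h3 : θ 0 ≤ 3 := hθ.2.2
  have key := (bMap (s + 1)).eval_snoc_snoc_cfVal le_rfl ha (by norm_num) (by omega) hθ.1.1
  have h1 : seqCons a θ ∈ Dset := seqCons_mem ha (by omega) hθ.1 (by
    rw [maxNext, if_pos ha2]
    exact h3)
  have h2 : seqCons 1 (seqCons a θ) ∈ Dset := seqCons_mem le_rfl (by norm_num) h1 (by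
    rw [maxNext, if_pos (by norm_num), seqCons]
    omega)
  refine ⟨_, h2, fun d hd => pair_notMem_badPairs (getLast?_bW_succ s d hd), fun h => ?_, ?_⟩
  · simp only [seqCons, Prod.mk.injEq] at h
    omega
  · rw [key.2, cfVal_app_bW _ h2.1]

theorem Icc_subset_Ktil_add_union (s : ℕ) :
    Icc ((bMap (s + 1)).eval (1 - topVal) + (cMap s).eval (1 - topVal))
      (2 * (bMap (s + 1)).eval topVal) ⊆
      (Ktil (bW (s + 1)) + Kb (cW (s + 1))) ∪ (Kb (bW (s + 1)) + Kb (bW (s + 1))) := by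
  have h := isShift s
  intro x hx
  by_cases hx1 : x ≤ (bMap (s + 1)).eval ((3 - topVal) / 3) + (cMap s).eval topVal
  · have hc : ∀ c : Cell, c.last ≤ 3 →
        pts ((cMap s).snoc 1 le_rfl, c) ⊆ Kb (cW (s + 1)) := fun c hc =>
      (pts_snoc_subset (cMap s) le_rfl c .d14 hc (by decide) (by decide)).trans
        (pts_cMap_subset_Kb s)
    rcases h.Icc_subset_union ⟨hx.1, hx1⟩ with (h1 | h1) | h1
    · exact Or.inl (add_subset_add (pts_bMap_subset_Ktil s) (pts_cMap_subset_Kb s) h1)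
    · exact Or.inl (add_subset_add (pts_snoc_snoc_subset_Ktil s le_rfl one_le_two)
        (hc _ le_rfl) h1)
    · exact Or.inl (add_subset_add (pts_snoc_snoc_subset_Ktil s one_le_two le_rfl)
        (hc _ le_rfl) h1)
  · exact Or.inr (add_subset_add (pts_bMap_subset_Kb s) (pts_bMap_subset_Kb s)
      (h.Icc_subset_add_self ⟨by linarith [h.two_mul_eval_le], hx.2⟩))

theorem eval_add_eval_succ_le (s : ℕ) :
    (bMap (s + 2)).eval (1 - topVal) + (cMap (s + 1)).eval (1 - topVal) ≤
      2 * (bMap (s + 1)).eval topVal := by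
  have t1 := topVal_gt
  have t2 := topVal_lt
  have t3 := topVal_sq
  have t4 := topVal_cube
  have e1 : (bMap (s + 2)).eval (1 - topVal) = (bMap (s + 1)).eval ((42 - topVal) / 51) := by
    rw [bMap]
    apply CFMap.eval_snoc_snoc (y := (8 + topVal) / 37) <;> push_cast <;> linarith
  have e2 : (cMap (s + 1)).eval (1 - topVal) = (bMap (s + 1)).eval ((29 - topVal) / 37) := by
    rw [cMap]
    apply CFMap.eval_snoc_snoc (y := (7 + topVal) / 25) <;> push_cast <;> linarith
  have h := isShift s
  have key : (bMap (s + 1)).len topVal ((42 - topVal) / 51) ≤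
      (bMap (s + 1)).len ((29 - topVal) / 37) topVal := by
    apply h.len_le_len <;> linarith
  rw [← h.sub_eq_len (by linarith) (by linarith), ← h.sub_eq_len (by linarith) (by linarith)] at key
  linarith

theorem eval_add_eval_zero_le :
    (bMap 1).eval (1 - topVal) + (cMap 0).eval (1 - topVal) ≤ 2 * topVal := by
  have t1 := topVal_gt
  have t2 := topVal_lt
  have t3 := topVal_sq
  have h0 : ∀ x, (bMap 0).eval x = x := fun x => by simp [bMap, CFMap.eval]
  have e1 : (bMap 1).eval (1 - topVal) = (bMap 0).eval ((42 - topVal) / 51) := by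
    rw [bMap]
    apply CFMap.eval_snoc_snoc (y := (8 + topVal) / 37) <;> push_cast <;> linarith
  have e2 : (cMap 0).eval (1 - topVal) = (bMap 0).eval ((29 - topVal) / 37) := by
    rw [cMap]
    apply CFMap.eval_snoc_snoc (y := (7 + topVal) / 25) <;> push_cast <;> linarith
  rw [e1, e2, h0, h0]
  linarith

theorem bMap_eval_fixed (s : ℕ) : (bMap s).eval (2 * √2 - 2) = 2 * √2 - 2 := by
  have h2 : √2 ^ 2 = 2 := Real.sq_sqrt zero_le_two
  have h1 : 1 ≤ √2 := Real.one_le_sqrt.2 one_le_two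
  induction s with
  | zero => simp [bMap, CFMap.eval]
  | succ s ih =>
    rw [bMap, CFMap.eval_snoc_snoc (y := (√2 - 1) / 2) (z := 2 * √2 - 2), ih]
    · linarith
    · push_cast; linarith
    · push_cast; linarith

theorem tendsto_bMap_eval :
    Tendsto (fun s => (bMap s).eval topVal) atTop (𝓝 (2 * √2 - 2)) := by
  have t1 := topVal_gt
  have t2 := topVal_lt
  have h1 : 1.414 < √2 := Real.lt_sqrt_of_sq_lt (by norm_num)
  have h2 : √2 < 1.415 := (Real.sqrt_lt' (by norm_num)).2 (by norm_num)
  refine tendsto_iff_dist_tendsto_zero.2 (squeeze_zero (fun _ => dist_nonneg) (fun s => ?_)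
    tendsto_one_div_add_atTop_nhds_zero_nat)
  have hq := (bMap_q s).1
  have hs : (0 : ℝ) ≤ s := s.cast_nonneg
  have h3 := (bMap s).eval_sub (x := topVal) (y := 2 * √2 - 2) (by linarith) (by linarith)
  have h4 := (bMap s).len_nonneg (x := topVal) (y := 2 * √2 - 2) (by linarith) (by linarith)
  rw [bMap_det, one_mul, bMap_eval_fixed] at h3
  rw [dist_comm, Real.dist_eq, h3, abs_of_nonneg h4, CFMap.len]
  have e1 : (s : ℝ) + 1 ≤ (bMap s).q + (bMap s).q' * topVal := by
    have := mul_nonneg (bMap s).q'_nonneg (by linarith : 0 ≤ topVal)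
    linarith
  have e2 : 1 ≤ (bMap s).q + (bMap s).q' * (2 * √2 - 2) := by
    have := mul_nonneg (bMap s).q'_nonneg (by linarith : 0 ≤ 2 * √2 - 2)
    linarith
  exact div_le_div₀ zero_le_one (by linarith) (by linarith) (by nlinarith)

/-- The union over `s ≥ 1` of `4 + (K̃(b^s) + K(c^s))` and `4 + (K(b^s) + K(b^s))`
covers the half-open interval `[1 + √21, √32)`. -/
theorem covering_interval :
    Set.Ico (1 + Real.sqrt 21) (Real.sqrt 32) ⊆
      ⋃ (s : ℕ) (_ : 1 ≤ s),
        ({(4 : ℝ)} + (Ktil (bW s) + Kb (cW s))) ∪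
          ({(4 : ℝ)} + (Kb (bW s) + Kb (bW s))) := by
  rintro x ⟨hx1, hx2⟩
  have h32 : √32 = 4 * √2 := by
    rw [show (32 : ℝ) = 4 ^ 2 * 2 by norm_num, Real.sqrt_mul (by norm_num),
      Real.sqrt_sq (by norm_num)]
  have hlo : 2 * topVal ≤ x - 4 := by
    unfold topVal
    linarith
  have hex : ∃ s, x - 4 ≤ 2 * (bMap (s + 1)).eval topVal := by
    have hlim := ((tendsto_add_atTop_iff_nat 1).2 tendsto_bMap_eval).const_mul 2
    obtain ⟨s, hs⟩ := (hlim.eventually (lt_mem_nhds (a := x - 4) (by linarith))).exists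
    exact ⟨s, hs.le⟩
  classical
  obtain ⟨s, hs, hmin⟩ : ∃ s, x - 4 ≤ 2 * (bMap (s + 1)).eval topVal ∧
      (bMap (s + 1)).eval (1 - topVal) + (cMap s).eval (1 - topVal) ≤ x - 4 := by
    refine ⟨Nat.find hex, Nat.find_spec hex, ?_⟩
    rcases hn : Nat.find hex with _ | n
    · exact eval_add_eval_zero_le.trans hlo
    · have := Nat.find_min hex (m := n) (by omega)
      exact (eval_add_eval_succ_le n).trans (not_le.1 this).le
  refine mem_iUnion₂.2 ⟨s + 1, by omega, ?_⟩
  rw [← add_union]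
  exact ⟨4, rfl, x - 4, Icc_subset_Ktil_add_union s ⟨hmin, hs⟩, by ring⟩
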